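/- Let (J,a) be a partial m×n matrix over a field 𝔽 whose pattern J is triangular. Then mr_b(J,a) = b · mr(J,a) for every integer b ≥ 1, and consequently fmr(J,a) = mr(J,a). -/

import Mathlib

open Matrix

variable {F : Type*} [Field F] {m n : Type*} [Fintype m] [Fintype n]

/-- `B` is a completion of the partial matrix `(J, a)`: it agrees with the
prescribed entries on the pattern `J`. -/
def Completes (J : Set (m × n)) (a : m → n → F) (B : Matrix m n F) : Prop :=
  ∀ p ∈ J, B p.1 p.2 = a p.1 p.2

/-- Minimal rank of the partial matrix `(J, a)`: the minimum of the ranks of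
all completions. -/
noncomputable def pmr (J : Set (m × n)) (a : m → n → F) : ℕ :=
  sInf {r : ℕ | ∃ B : Matrix m n F, Completes J a B ∧ B.rank = r}

/-- A pattern `T` is triangular if whenever `(i,j) ∈ T` and `(k,l) ∈ T`,
then `(i,l) ∈ T` or `(k,j) ∈ T`. -/
def Triangular (T : Set (m × n)) : Prop :=
  ∀ p ∈ T, ∀ q ∈ T, (p.1, q.2) ∈ T ∨ (q.1, p.2) ∈ T

/-- Triangular minimal rank: the maximum of `pmr` over triangular
subpatterns of `J`. -/
noncomputable def ptmr (J : Set (m × n)) (a : m → n → F) : ℕ :=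
  sSup {r : ℕ | ∃ T ⊆ J, Triangular T ∧ pmr T a = r}

/-- Pattern of the tensor `(J,a) ⊗ I_b`. -/
def TensorJ (J : Set (m × n)) (b : ℕ) : Set ((m × Fin b) × (n × Fin b)) :=
  {p | (p.1.1, p.2.1) ∈ J}

/-- Entries of the tensor `(J,a) ⊗ I_b`: `a i j` on the diagonal of each
`b × b` block, `0` off the diagonal. -/
def TensorA (a : m → n → F) (b : ℕ) : m × Fin b → n × Fin b → F :=
  fun ip jq => if ip.2 = jq.2 then a ip.1 jq.1 else 0

/-- `b`-fold minimal rank `mr_b(J,a) = mr((J,a) ⊗ I_b)`. -/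
noncomputable def pmrb (J : Set (m × n)) (a : m → n → F) (b : ℕ) : ℕ :=
  pmr (TensorJ J b) (TensorA a b)

/-- Fractional minimal rank: `inf_{b ≥ 1} mr_b(J,a) / b`. -/
noncomputable def pfmr (J : Set (m × n)) (a : m → n → F) : ℝ :=
  ⨅ b : ℕ+, (pmrb J a b : ℝ) / (b : ℝ)

/-- Along the rows of a triangular pattern, ordered by the number of prescribed entries, greedy
elimination finds a set `S` of rows such that the pattern can be completed with rank at most `#S`,
while in every completion of every tensor power the rows over `S` are linearly independent. -/
lemma Triangular.exists_pivot_rows [DecidableEq m] {J : Set (m × n)} (hJ : Triangular J)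
    (a : m → n → F) (R : Finset m) :
    ∃ S ⊆ R,
      (∃ (P : m → m → F) (Q : m → n → F), ∀ i ∈ R, ∀ j, (i, j) ∈ J →
        ∑ k ∈ S, P i k * Q k j = a i j) ∧
      ∀ (b : ℕ) (C : Matrix (m × Fin b) (n × Fin b) F),
        Completes (TensorJ J b) (TensorA a b) C →
        ∀ g : m → Fin b → F, (∀ x, ∑ k ∈ S, ∑ p, g k p * C (k, p) x = 0) →
          ∀ k ∈ S, ∀ p, g k p = 0 := by
  induction R using Finset.induction_on_min_value (fun i => {j | (i, j) ∈ J}.ncard) with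
  | empty => exact ⟨∅, by simp⟩
  | insert r R hr hmin ih =>
    obtain ⟨S, hSR, ⟨P, Q, hPQ⟩, hind⟩ := ih
    have hsub : ∀ i ∈ R, ∀ j, (r, j) ∈ J → (i, j) ∈ J := by
      intro i hi j hj
      by_contra hij
      have hle : {l | (i, l) ∈ J} ⊆ {l | (r, l) ∈ J} := fun l hl =>
        (hJ (r, j) hj (i, l) hl).resolve_right hij
      have heq := Set.eq_of_subset_of_ncard_le hle (hmin i hi)
      exact hij (heq.symm.subset hj)
    by_cases hspan : ∃ c : m → F, ∀ j, (r, j) ∈ J → ∑ k ∈ R, c k * a k j = a r j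
    · obtain ⟨c, hc⟩ := hspan
      refine ⟨S, hSR.trans (Finset.subset_insert r R),
        ⟨fun i k => if i = r then ∑ l ∈ R, c l * P l k else P i k, Q, fun i hi j hij => ?_⟩, hind⟩
      obtain rfl | hi := Finset.mem_insert.mp hi
      · rw [← hc j hij]
        simp only [if_true, Finset.sum_mul]
        rw [Finset.sum_comm]
        refine Finset.sum_congr rfl fun l hl => ?_
        rw [← hPQ l hl j (hsub l hl j hij), Finset.mul_sum]
        exact Finset.sum_congr rfl fun k _ => mul_assoc _ _ _
      · simpa [ne_of_mem_of_not_mem hi hr] using hPQ i hi j hij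
    · have hrS : r ∉ S := fun h => hr (hSR h)
      refine ⟨insert r S, Finset.insert_subset_insert r hSR,
        ⟨fun i k => if k = r then (if i = r then 1 else 0) else if i = r then 0 else P i k,
          fun k => if k = r then a r else Q k, fun i hi j hij => ?_⟩, fun b C hC g hg => ?_⟩
      · have hne : ∀ k ∈ S, k ≠ r := fun k hk => ne_of_mem_of_not_mem hk hrS
        rw [Finset.sum_insert hrS]
        obtain rfl | hi := Finset.mem_insert.mp hi
        · rw [Finset.sum_eq_zero fun k hk => by simp [hne k hk]]
          simp
        · have hir : i ≠ r := ne_of_mem_of_not_mem hi hr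
          simp only [if_true, if_neg hir, zero_mul, zero_add]
          rw [← hPQ i hi j hij]
          exact Finset.sum_congr rfl fun k hk => by rw [if_neg (hne k hk), if_neg (hne k hk)]
      · have hzero : ∀ p, g r p = 0 := by
          intro p
          by_contra hp
          refine hspan ⟨fun k => if k ∈ S then -(g r p)⁻¹ * g k p else 0, fun j hj => ?_⟩
          have hrow : ∀ k, (k, j) ∈ J → ∑ q, g k q * C (k, q) (j, p) = g k p * a k j := by
            intro k hk
            rw [Finset.sum_congr rfl fun q _ => by rw [hC ((k, q), (j, p)) hk]]
            simp [TensorA]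
          have h := hg (j, p)
          rw [Finset.sum_insert hrS, hrow r hj,
            Finset.sum_congr rfl fun k hk => hrow k (hsub k (hSR hk) j hj)] at h
          simp only [ite_mul, zero_mul]
          rw [← Finset.sum_filter, Finset.filter_mem_eq_inter,
            Finset.inter_eq_right.mpr hSR]
          simp only [mul_assoc]
          rw [← Finset.mul_sum, eq_neg_of_add_eq_zero_right h]
          field_simp
        have hS := hind b C hC g fun x => by
          simpa [Finset.sum_insert hrS, hzero] using hg x
        intro k hk
        obtain rfl | hk := Finset.mem_insert.mp hk
        · exact hzero
        · exact hS k hk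

set_option linter.unusedSectionVars false in
lemma pmr_le_rank {J : Set (m × n)} {a : m → n → F} {B : Matrix m n F}
    (hB : Completes J a B) : pmr J a ≤ B.rank :=
  Nat.sInf_le ⟨B, hB, rfl⟩

set_option linter.unusedSectionVars false in
lemma le_pmr {J : Set (m × n)} {a : m → n → F} {r : ℕ}
    (h : ∀ B : Matrix m n F, Completes J a B → r ≤ B.rank) : r ≤ pmr J a := by
  refine le_csInf ⟨_, Matrix.of a, fun _ _ => rfl, rfl⟩ ?_
  rintro _ ⟨B, hB, rfl⟩
  exact h B hB

/-- For a triangular pattern, the minimal rank and all its tensor powers are determined by the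
number of pivot rows. -/
lemma Triangular.exists_pmr_eq {J : Set (m × n)} (hJ : Triangular J) (a : m → n → F) :
    ∃ s : ℕ, pmr J a = s ∧ ∀ b, pmrb J a b = b * s := by
  classical
  obtain ⟨S, -, ⟨P, Q, hPQ⟩, hind⟩ := hJ.exists_pivot_rows a Finset.univ
  have hsum : ∀ i j, (i, j) ∈ J → ∑ k : S, P i k * Q k j = a i j := fun i j hij => by
    rw [← hPQ i (Finset.mem_univ i) j hij, ← Finset.sum_coe_sort S fun k => P i k * Q k j]
  have hlower : ∀ (b : ℕ) (C : Matrix (m × Fin b) (n × Fin b) F),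
      Completes (TensorJ J b) (TensorA a b) C → b * S.card ≤ C.rank := by
    intro b C hC
    have hli : LinearIndependent F
        (C.submatrix (fun x : S × Fin b => ((x.1 : m), x.2)) id).row := by
      rw [Fintype.linearIndependent_iff]
      rintro g hg ⟨⟨k, hk⟩, p⟩
      have h := hind b C hC (fun k p => if hk : k ∈ S then g (⟨k, hk⟩, p) else 0)
        (fun x => ?_) k hk p
      · simpa [hk] using h
      · rw [← Finset.sum_coe_sort S]
        simpa [Fintype.sum_prod_type, Finset.sum_apply] using congrFun hg x
    have h := hli.rank_matrix.symm.trans_le (Matrix.rank_submatrix_le C _ _)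
    simpa [mul_comm] using h
  refine ⟨S.card, le_antisymm ?_ (le_pmr fun B hB => ?_), fun b => le_antisymm ?_ ?_⟩
  · let L : Matrix m S F := Matrix.of fun i k => P i k
    let M : Matrix S n F := Matrix.of fun k j => Q k j
    refine (pmr_le_rank (B := L * M) fun x hx => hsum x.1 x.2 hx).trans ?_
    simpa using (Matrix.rank_mul_le_left L M).trans L.rank_le_card_width
  · have h := hlower 1 (B.submatrix Prod.fst Prod.fst) fun x hx => by
      simpa [TensorA, Subsingleton.elim x.1.2 x.2.2] using hB (x.1.1, x.2.1) hx
    simpa using h.trans (Matrix.rank_submatrix_le B _ _)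
  · let L : Matrix (m × Fin b) (S × Fin b) F :=
      Matrix.of fun x y => if x.2 = y.2 then P x.1 y.1 else 0
    let M : Matrix (S × Fin b) (n × Fin b) F :=
      Matrix.of fun x y => if x.2 = y.2 then Q x.1 y.1 else 0
    refine (pmr_le_rank (B := L * M) fun x hx => ?_).trans ?_
    · obtain ⟨⟨i, p⟩, j, q⟩ := x
      have hdiag := hsum i j hx
      rcases eq_or_ne p q with rfl | h
      · simpa [L, M, Matrix.mul_apply, Fintype.sum_prod_type, TensorA] using hdiag
      · simp [L, M, Matrix.mul_apply, Fintype.sum_prod_type, TensorA, h]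
    · simpa [mul_comm] using (Matrix.rank_mul_le_left L M).trans L.rank_le_card_width
  · exact le_pmr fun C hC => hlower b C hC

/-- If the pattern `J` is triangular, then
`mr_b(J,a) = b · mr(J,a)` for every `b ≥ 1`, and consequently
`fmr(J,a) = mr(J,a)`. -/
theorem stmt11 {F : Type*} [Field F] (m n : ℕ)
    (J : Set (Fin m × Fin n)) (a : Fin m → Fin n → F)
    (hJ : Triangular J) :
    (∀ b : ℕ, 1 ≤ b → pmrb J a b = b * pmr J a) ∧
      pfmr J a = (pmr J a : ℝ) := by
  obtain ⟨s, hs, hb⟩ := hJ.exists_pmr_eq a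
  refine ⟨fun b _ => by rw [hb, hs], ?_⟩
  have h : ∀ b : ℕ+, (pmrb J a b : ℝ) / (b : ℝ) = s := fun b => by
    rw [hb, Nat.cast_mul, mul_div_cancel_left₀ _ (Nat.cast_ne_zero.mpr b.ne_zero)]
  simp [pfmr, h, hs]
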